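/- Σ_ι[λ] is a subcrystal of X+ ⊗ t_λ ⊗ X−: one has Σ_ι[λ] ⊆ X+ ⊗ t_λ ⊗ X−, and for every x ∈ Σ_ι[λ] and i ∈ I, if ẽ_i(x) ≠ 0 then ẽ_i(x) ∈ Σ_ι[λ], and if f̃_i(x) ≠ 0 then f̃_i(x) ∈ Σ_ι[λ]. -/

import Mathlib

open Filter Function

namespace HypCrystal

variable (a1 a2 k1 k2 : ℤ)

/-- `i_k`: 1 if `k` is odd, 2 if `k` is even. -/
def idx (k : ℤ) : ℤ := if k % 2 = 1 then 1 else 2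

/-- membership in the index set `I = {1,2}`. -/
def IsI (i : ℤ) : Prop := i = 1 ∨ i = 2

/-- `⟨α_{i_j}, α_{i_k}^∨⟩`. -/
def pairJK (j k : ℤ) : ℤ :=
  if j % 2 = k % 2 then 2 else if k % 2 = 1 then -a1 else -a2

/-- `⟨α_{i_j}, α_i^∨⟩` for `i ∈ {1,2}`. -/
def pairJI (j i : ℤ) : ℤ :=
  if idx j = i then 2 else if i = 1 then -a1 else -a2

/-- `α_{i_j}` in the `(Λ1, Λ2)`-coordinates. -/
def alphaOf (j : ℤ) : ℤ × ℤ := if j % 2 = 1 then (2, -a2) else (-a1, 2)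

/-- `⟨ν, α_i^∨⟩` for a weight `ν` in `(Λ1, Λ2)`-coordinates. -/
def pairW (ν : ℤ × ℤ) (i : ℤ) : ℤ := if i = 1 then ν.1 else ν.2

/-- the sequence `c_j`. -/
def cseq : ℕ → ℤ
  | 0 => 0
  | 1 => 1
  | j + 2 => (if j % 2 = 0 then a1 else a2) * cseq (j + 1) - cseq j

/-- the sequence `c'_j`. -/
def cseq' : ℕ → ℤ
  | 0 => 0
  | 1 => 1
  | j + 2 => (if j % 2 = 0 then a2 else a1) * cseq' (j + 1) - cseq' j

noncomputable def alphaR : ℝ :=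
  ((a1 : ℝ) * a2 + Real.sqrt ((a1 : ℝ) ^ 2 * (a2 : ℝ) ^ 2 - 4 * a1 * a2)) / (2 * a2)

noncomputable def betaR : ℝ :=
  ((a1 : ℝ) * a2 + Real.sqrt ((a1 : ℝ) ^ 2 * (a2 : ℝ) ^ 2 - 4 * a1 * a2)) / (2 * a1)

/-- `γ_k = α` if `k` even, `β` if `k` odd. -/
noncomputable def gammaR (k : ℤ) : ℝ := if k % 2 = 0 then alphaR a1 a2 else betaR a1 a2

/-- `p_m` for `m ≥ 0`. -/
def ppos : ℕ → ℤ
  | 0 => k2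
  | 1 => k1
  | m + 2 => (if m % 2 = 0 then a2 else a1) * ppos (m + 1) - ppos m

/-- `p_{-n}` for `n ≥ 0`. -/
def pneg : ℕ → ℤ
  | 0 => k2
  | 1 => a1 * k2 - k1
  | n + 2 => (if (n + 2) % 2 = 0 then a2 else a1) * pneg (n + 1) - pneg n

/-- the two-sided sequence `p_m`, `m ∈ ℤ`, with `p_0 = k2`, `p_1 = k1`. -/
def pseq (m : ℤ) : ℤ :=
  if 0 ≤ m then ppos a1 a2 k1 k2 m.toNat else pneg a1 a2 k1 k2 (-m).toNat

/-- `λ = k1·Λ1 − k2·Λ2` in `(Λ1, Λ2)`-coordinates. -/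
def lamW : ℤ × ℤ := (k1, -k2)

/-- membership in `ℤ^{+∞}` (coordinates supported on positions `≥ 1`, nonnegative,
finitely supported). -/
def ZPlusMem (x : ℤ → ℤ) : Prop :=
  (∀ k : ℤ, k ≤ 0 → x k = 0) ∧ (∀ k : ℤ, 0 ≤ x k) ∧ ∃ N : ℕ, ∀ k : ℤ, (N : ℤ) < k → x k = 0

/-- membership in `ℤ^{−∞}` (coordinates supported on positions `≤ 0`, nonpositive,
finitely supported). -/
def ZMinusMem (x : ℤ → ℤ) : Prop :=
  (∀ k : ℤ, 1 ≤ k → x k = 0) ∧ (∀ k : ℤ, x k ≤ 0) ∧ ∃ N : ℕ, ∀ k : ℤ, k < -(N : ℤ) → x k = 0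

/-- membership in `X+ = Img(Ψ⁺)`. -/
def XPlusMem (x : ℤ → ℤ) : Prop :=
  ZPlusMem x ∧ ∀ j : ℤ, 1 ≤ j →
    0 ≤ cseq a1 a2 j.toNat * x j - cseq a1 a2 (j - 1).toNat * x (j + 1)

/-- membership in `X− = Img(Ψ⁻)`. -/
def XMinusMem (x : ℤ → ℤ) : Prop :=
  ZMinusMem x ∧ ∀ j : ℤ, j ≤ 0 →
    cseq' a1 a2 (1 - j).toNat * x j - cseq' a1 a2 (-j).toNat * x (j - 1) ≤ 0

def posPart (x : ℤ → ℤ) : ℤ → ℤ := fun k => if 1 ≤ k then x k else 0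
def negPart (x : ℤ → ℤ) : ℤ → ℤ := fun k => if k ≤ 0 then x k else 0

/-- membership in `Z_ι(μ) = ℤ^{+∞} ⊗ t_μ ⊗ ℤ^{−∞}` (in coordinates). -/
def ZMem (x : ℤ → ℤ) : Prop := ZPlusMem (posPart x) ∧ ZMinusMem (negPart x)

/-- membership in `X+ ⊗ t_λ ⊗ X−` (in coordinates). -/
def XXMem (x : ℤ → ℤ) : Prop := XPlusMem a1 a2 (posPart x) ∧ XMinusMem a1 a2 (negPart x)

/-- `σ_k` on `ℤ^{+∞}` (for `k ≥ 1`). -/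
noncomputable def sigmaP (x : ℤ → ℤ) (k : ℤ) : ℤ :=
  x k + ∑ᶠ j : ℤ, if k < j then pairJK a1 a2 j k * x j else 0

/-- `σ_k` on `ℤ^{−∞}` (for `k ≤ 0`). -/
noncomputable def sigmaM (x : ℤ → ℤ) (k : ℤ) : ℤ :=
  -(x k) - ∑ᶠ j : ℤ, if j < k then pairJK a1 a2 j k * x j else 0

/-- `−Σ_j x_j α_{i_j}` in `(Λ1, Λ2)`-coordinates. -/
noncomputable def wtOf (x : ℤ → ℤ) : ℤ × ℤ :=
  (-∑ᶠ j : ℤ, x j * (alphaOf a1 a2 j).1, -∑ᶠ j : ℤ, x j * (alphaOf a1 a2 j).2)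

/-- `wt(x) = μ − Σ_j x_j α_{i_j}`. -/
noncomputable def wtZ (μ : ℤ × ℤ) (x : ℤ → ℤ) : ℤ × ℤ := μ + wtOf a1 a2 x

/-- `σ_k` on `Z_ι(μ)`. -/
noncomputable def sigmaZ (μ : ℤ × ℤ) (x : ℤ → ℤ) (k : ℤ) : ℤ :=
  if 1 ≤ k then sigmaP a1 a2 x k
  else sigmaM a1 a2 x k - pairW (wtZ a1 a2 μ x) (idx k)

/-- `ε_i` on `Z_ι(μ)`. -/
noncomputable def epsZ (μ : ℤ × ℤ) (x : ℤ → ℤ) (i : ℤ) : ℤ :=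
  sSup {s : ℤ | ∃ k : ℤ, idx k = i ∧ sigmaZ a1 a2 μ x k = s}

/-- `φ_i` on `Z_ι(μ)`. -/
noncomputable def phiZ (μ : ℤ × ℤ) (x : ℤ → ℤ) (i : ℤ) : ℤ :=
  epsZ a1 a2 μ x i + pairW (wtZ a1 a2 μ x) i

noncomputable def kmaxZ (μ : ℤ × ℤ) (x : ℤ → ℤ) (i : ℤ) : ℤ :=
  sSup {k : ℤ | idx k = i ∧ sigmaZ a1 a2 μ x k = epsZ a1 a2 μ x i}

noncomputable def kminZ (μ : ℤ × ℤ) (x : ℤ → ℤ) (i : ℤ) : ℤ :=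
  sInf {k : ℤ | idx k = i ∧ sigmaZ a1 a2 μ x k = epsZ a1 a2 μ x i}

/-- `ẽ_i` on `Z_ι(μ)`; `none` represents `0`. -/
noncomputable def eZ (μ : ℤ × ℤ) (i : ℤ) (x : ℤ → ℤ) : Option (ℤ → ℤ) :=
  if 0 < epsZ a1 a2 μ x i then
    some (Function.update x (kmaxZ a1 a2 μ x i) (x (kmaxZ a1 a2 μ x i) - 1))
  else none

/-- `f̃_i` on `Z_ι(μ)`; `none` represents `0`. -/
noncomputable def fZ (μ : ℤ × ℤ) (i : ℤ) (x : ℤ → ℤ) : Option (ℤ → ℤ) :=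
  if 0 < phiZ a1 a2 μ x i then
    some (Function.update x (kminZ a1 a2 μ x i) (x (kminZ a1 a2 μ x i) + 1))
  else none

/-- `ε_i` on `ℤ^{+∞}`. -/
noncomputable def epsP (x : ℤ → ℤ) (i : ℤ) : ℤ :=
  sSup {s : ℤ | ∃ k : ℤ, 1 ≤ k ∧ idx k = i ∧ sigmaP a1 a2 x k = s}

noncomputable def kmaxP (x : ℤ → ℤ) (i : ℤ) : ℤ :=
  sSup {k : ℤ | 1 ≤ k ∧ idx k = i ∧ sigmaP a1 a2 x k = epsP a1 a2 x i}

noncomputable def kminP (x : ℤ → ℤ) (i : ℤ) : ℤ :=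
  sInf {k : ℤ | 1 ≤ k ∧ idx k = i ∧ sigmaP a1 a2 x k = epsP a1 a2 x i}

/-- `ẽ_i` on `ℤ^{+∞}` (partial). -/
noncomputable def eP (i : ℤ) (x : ℤ → ℤ) : Option (ℤ → ℤ) :=
  if 0 < epsP a1 a2 x i then
    some (Function.update x (kmaxP a1 a2 x i) (x (kmaxP a1 a2 x i) - 1))
  else none

/-- `f̃_i` on `ℤ^{+∞}` (total). -/
noncomputable def fP (i : ℤ) (x : ℤ → ℤ) : ℤ → ℤ :=
  Function.update x (kminP a1 a2 x i) (x (kminP a1 a2 x i) + 1)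

/-- `φ_i` on `ℤ^{−∞}`. -/
noncomputable def phiMf (x : ℤ → ℤ) (i : ℤ) : ℤ :=
  sSup {s : ℤ | ∃ k : ℤ, k ≤ 0 ∧ idx k = i ∧ sigmaM a1 a2 x k = s}

noncomputable def kmaxM (x : ℤ → ℤ) (i : ℤ) : ℤ :=
  sSup {k : ℤ | k ≤ 0 ∧ idx k = i ∧ sigmaM a1 a2 x k = phiMf a1 a2 x i}

noncomputable def kminM (x : ℤ → ℤ) (i : ℤ) : ℤ :=
  sInf {k : ℤ | k ≤ 0 ∧ idx k = i ∧ sigmaM a1 a2 x k = phiMf a1 a2 x i}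

/-- `ẽ_i` on `ℤ^{−∞}` (total). -/
noncomputable def eM (i : ℤ) (x : ℤ → ℤ) : ℤ → ℤ :=
  Function.update x (kmaxM a1 a2 x i) (x (kmaxM a1 a2 x i) - 1)

noncomputable def fPiter (i : ℤ) (n : ℕ) (x : ℤ → ℤ) : ℤ → ℤ := (fP a1 a2 i)^[n] x

noncomputable def eMiter (i : ℤ) (n : ℕ) (x : ℤ → ℤ) : ℤ → ℤ := (eM a1 a2 i)^[n] x

noncomputable def ePiterO (i : ℤ) (n : ℕ) (ox : Option (ℤ → ℤ)) : Option (ℤ → ℤ) :=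
  (fun o => o.bind (eP a1 a2 i))^[n] ox

noncomputable def eZiterO (μ : ℤ × ℤ) (i : ℤ) (n : ℕ) (ox : Option (ℤ → ℤ)) : Option (ℤ → ℤ) :=
  (fun o => o.bind (eZ a1 a2 μ i))^[n] ox

noncomputable def fZiterO (μ : ℤ × ℤ) (i : ℤ) (n : ℕ) (ox : Option (ℤ → ℤ)) : Option (ℤ → ℤ) :=
  (fun o => o.bind (fZ a1 a2 μ i))^[n] ox

noncomputable def suppBoundP (x : ℤ → ℤ) : ℕ := sInf {N : ℕ | ∀ k : ℤ, (N : ℤ) < k → x k = 0}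

noncomputable def suppBoundM (x : ℤ → ℤ) : ℕ := sInf {N : ℕ | ∀ k : ℤ, k < -(N : ℤ) → x k = 0}

/-- `starPChain x n z = f̃_{i_1}^{x_1} ⋯ f̃_{i_n}^{x_n} (z)` on `ℤ^{+∞}`. -/
noncomputable def starPChain (x : ℤ → ℤ) : ℕ → (ℤ → ℤ) → (ℤ → ℤ)
  | 0, z => z
  | n + 1, z => starPChain x n (fPiter a1 a2 (idx ((n : ℤ) + 1)) ((x ((n : ℤ) + 1)).toNat) z)

/-- the `∗`-operation on `X+`: `(x⁺)* = f̃_{i_1}^{x_1} ⋯ f̃_{i_N}^{x_N} (z_∞)`. -/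
noncomputable def starP (x : ℤ → ℤ) : ℤ → ℤ :=
  starPChain a1 a2 x (suppBoundP x) (fun _ => 0)

/-- `starMChain x n z = ẽ_{i_0}^{−x_0} ⋯ ẽ_{i_{-(n-1)}}^{−x_{-(n-1)}} (z)` on `ℤ^{−∞}`. -/
noncomputable def starMChain (x : ℤ → ℤ) : ℕ → (ℤ → ℤ) → (ℤ → ℤ)
  | 0, z => z
  | n + 1, z => starMChain x n (eMiter a1 a2 (idx (-(n : ℤ))) ((-(x (-(n : ℤ)))).toNat) z)

/-- the `∗`-operation on `X−`. -/
noncomputable def starM (x : ℤ → ℤ) : ℤ → ℤ :=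
  starMChain a1 a2 x (suppBoundM x + 1) (fun _ => 0)

/-- combine a `ℤ^{+∞}`- and a `ℤ^{−∞}`-component into an element of `Z_ι(μ)`. -/
def combine (y z : ℤ → ℤ) : ℤ → ℤ := fun k => if 1 ≤ k then y k else z k

/-- the coordinates of `x* = (x⁺)* ⊗ t_μ ⊗ (x⁻)*`. -/
noncomputable def xstarFun (x : ℤ → ℤ) : ℤ → ℤ :=
  combine (starP a1 a2 (posPart x)) (starM a1 a2 (negPart x))

/-- the weight `μ = −λ − wt(x⁺) − wt(x⁻)` of `x*`. -/
noncomputable def mustar (lam : ℤ × ℤ) (x : ℤ → ℤ) : ℤ × ℤ :=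
  -lam - wtOf a1 a2 (posPart x) - wtOf a1 a2 (negPart x)

/-- `fPnegChain g n z = f̃_{i_{-(n-1)}}^{g(-(n-1))} ⋯ f̃_{i_{-1}}^{g(-1)} f̃_{i_0}^{g 0} (z)`. -/
noncomputable def fPnegChain (g : ℤ → ℕ) : ℕ → (ℤ → ℤ) → (ℤ → ℤ)
  | 0, z => z
  | n + 1, z => fPiter a1 a2 (idx (-(n : ℤ))) (g (-(n : ℤ))) (fPnegChain g n z)

/-- `eMposChain g n z = ẽ_{i_n}^{g n} ⋯ ẽ_{i_2}^{g 2} ẽ_{i_1}^{g 1} (z)`. -/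
noncomputable def eMposChain (g : ℤ → ℕ) : ℕ → (ℤ → ℤ) → (ℤ → ℤ)
  | 0, z => z
  | n + 1, z => eMiter a1 a2 (idx ((n : ℤ) + 1)) (g ((n : ℤ) + 1)) (eMposChain g n z)

/-- `ePposChainO g n z = ẽ_{i_n}^{g n} ⋯ ẽ_{i_2}^{g 2} ẽ_{i_1}^{g 1} (z)` on `ℤ^{+∞}`. -/
noncomputable def ePposChainO (g : ℤ → ℕ) : ℕ → Option (ℤ → ℤ) → Option (ℤ → ℤ)
  | 0, z => z
  | n + 1, z => ePiterO a1 a2 (idx ((n : ℤ) + 1)) (g ((n : ℤ) + 1)) (ePposChainO g n z)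

/-- the Weyl group action `S_i` on `Z_ι(μ) ∪ {0}`. -/
noncomputable def SiO (μ : ℤ × ℤ) (i : ℤ) (ob : Option (ℤ → ℤ)) : Option (ℤ → ℤ) :=
  ob.bind fun b =>
    if 0 ≤ pairW (wtZ a1 a2 μ b) i then
      fZiterO a1 a2 μ i (pairW (wtZ a1 a2 μ b) i).toNat (some b)
    else eZiterO a1 a2 μ i (-(pairW (wtZ a1 a2 μ b) i)).toNat (some b)

/-- `SwPos μ n = S_{i_n} ⋯ S_{i_2} S_{i_1}`. -/
noncomputable def SwPos (μ : ℤ × ℤ) : ℕ → Option (ℤ → ℤ) → Option (ℤ → ℤ)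
  | 0, b => b
  | n + 1, b => SiO a1 a2 μ (idx ((n : ℤ) + 1)) (SwPos μ n b)

/-- `SwNeg μ n = S_{i_{-(n-1)}} ⋯ S_{i_{-1}} S_{i_0}`. -/
noncomputable def SwNeg (μ : ℤ × ℤ) : ℕ → Option (ℤ → ℤ) → Option (ℤ → ℤ)
  | 0, b => b
  | n + 1, b => SiO a1 a2 μ (idx (-(n : ℤ))) (SwNeg μ n b)

/-- `S_{w_k}`. -/
noncomputable def Swk (μ : ℤ × ℤ) (k : ℤ) (b : Option (ℤ → ℤ)) : Option (ℤ → ℤ) :=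
  if 0 ≤ k then SwPos a1 a2 μ k.toNat b else SwNeg a1 a2 μ (-k).toNat b

/-- `b ∈ Z_ι(μ)` is extremal. -/
noncomputable def Extremal (μ : ℤ × ℤ) (b : ℤ → ℤ) : Prop :=
  ∀ js : List ℤ, (∀ j ∈ js, IsI j) →
    ∃ b', js.foldr (SiO a1 a2 μ) (some b) = some b' ∧
      ∀ i : ℤ, IsI i →
        (0 ≤ pairW (wtZ a1 a2 μ b') i → eZ a1 a2 μ i b' = none) ∧
        (pairW (wtZ a1 a2 μ b') i ≤ 0 → fZ a1 a2 μ i b' = none)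

/-- `φ(x) ≥ 0` for all `φ ∈ Ξ_ι[λ]`. -/
noncomputable def SigmaCond (x : ℤ → ℤ) : Prop :=
  (0 ≤ gammaR a1 a2 0 * (pseq a1 a2 k1 k2 0 : ℝ) + gammaR a1 a2 0 * (x 0 : ℝ) - (x 1 : ℝ)) ∧
  (0 ≤ gammaR a1 a2 1 * (pseq a1 a2 k1 k2 1 : ℝ) + (x 0 : ℝ) - gammaR a1 a2 1 * (x 1 : ℝ)) ∧
  (∀ k : ℤ, 1 ≤ k → 0 ≤ (pseq a1 a2 k1 k2 k : ℝ) - (x k : ℝ)) ∧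
  (∀ k : ℤ, 1 ≤ k → 0 ≤ gammaR a1 a2 k * (x k : ℝ) - (x (k + 1) : ℝ)) ∧
  (∀ k : ℤ, 1 ≤ k → 0 ≤ gammaR a1 a2 (k + 1) * (pseq a1 a2 k1 k2 (k + 1) : ℝ) -
      (pseq a1 a2 k1 k2 k : ℝ) + (x k : ℝ) - gammaR a1 a2 (k + 1) * (x (k + 1) : ℝ)) ∧
  (∀ k : ℤ, k ≤ 0 → 0 ≤ (pseq a1 a2 k1 k2 k : ℝ) + (x k : ℝ)) ∧
  (∀ k : ℤ, k ≤ 0 → 0 ≤ (x (k - 1) : ℝ) - gammaR a1 a2 k * (x k : ℝ)) ∧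
  (∀ k : ℤ, k ≤ 0 → 0 ≤ gammaR a1 a2 (k - 1) * (pseq a1 a2 k1 k2 (k - 1) : ℝ) -
      (pseq a1 a2 k1 k2 k : ℝ) + gammaR a1 a2 (k - 1) * (x (k - 1) : ℝ) - (x k : ℝ))

/-- membership in `Σ_ι[λ]`. -/
noncomputable def SigmaMem (x : ℤ → ℤ) : Prop :=
  ZMem x ∧ SigmaCond a1 a2 k1 k2 x

/-- membership in `Σ'_ι[λ]`. -/
noncomputable def SigmaPrimeMem (x : ℤ → ℤ) : Prop :=
  SigmaMem a1 a2 k1 k2 x ∧ (∀ k : ℤ, k ≤ 0 → x k = 0) ∧ XPlusMem a1 a2 (posPart x)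

/-- evaluation of an affine function `φ = (c, (φ_l)_l)` at `x`. -/
noncomputable def evalAff (φ : ℝ × (ℤ → ℝ)) (x : ℤ → ℤ) : ℝ :=
  φ.1 + ∑ᶠ l : ℤ, φ.2 l * (x l : ℝ)

/-- `a_{i_k}`. -/
def aIdx (k : ℤ) : ℤ := if k % 2 = 1 then a1 else a2

/-- the affine function `b̄_k`. -/
noncomputable def bbar (lam : ℤ × ℤ) (k : ℤ) : ℝ × (ℤ → ℝ) :=
  ((if k = -1 ∨ k = 0 then -(pairW lam (idx k) : ℝ) else 0),
    fun l => (if l = k then (1 : ℝ) else 0) + (if l = k + 1 then -(aIdx a1 a2 k : ℝ) else 0) +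
      (if l = k + 2 then (1 : ℝ) else 0))

/-- the operator `S̄_k` on affine functions. -/
noncomputable def SbarOp (lam : ℤ × ℤ) (k : ℤ) (φ : ℝ × (ℤ → ℝ)) : ℝ × (ℤ → ℝ) :=
  let b := if 0 ≤ φ.2 k then bbar a1 a2 lam (k + 2) else bbar a1 a2 lam (k - 2)
  (φ.1 - φ.2 k * b.1, fun l => φ.2 l - φ.2 k * b.2 l)

end HypCrystal

namespace HypCrystal

variable {a1 a2 k1 k2 : ℤ} {g : ℤ → ℝ} {A p x z : ℤ → ℤ} {k : ℤ}

/-- The coefficient of the three-term recurrence of `pseq` centred at `k`. -/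
def recCoeff (a1 a2 k : ℤ) : ℤ := if k % 2 = 1 then a2 else a1

/-- Integer sequences between `0` and `p` whose growth to the right, and the growth to the left of
their complement in `p`, is bounded by `g`. -/
structure Admissible (g : ℤ → ℝ) (p z : ℤ → ℤ) : Prop where
  nonneg : ∀ k, 0 ≤ z k
  le : ∀ k, z k ≤ p k
  right : ∀ k, (z (k + 1) : ℝ) ≤ g k * z k
  left : ∀ k, (p (k - 1) : ℝ) - z (k - 1) ≤ g k * (p k - z k)

/-- The compatibility between the growth rates `g`, the recurrence coefficients `A` and the
solution `p` of the recurrence. -/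
structure RecurrenceData (g : ℤ → ℝ) (A p : ℤ → ℤ) : Prop where
  pos : ∀ k, 0 < g k
  periodic : ∀ k, g (k + 2) = g k
  coeff : ∀ k, (A k : ℝ) = g k + (g (k + 1))⁻¹
  rec_eq : ∀ k, p k - A (k + 1) * p (k + 1) + p (k + 2) = 0

theorem Admissible.update_sub_one (hd : RecurrenceData g A p) (h : Admissible g p z)
    (hk : 0 < z k - A (k + 1) * z (k + 1) + z (k + 2)) :
    Admissible g p (update z k (z k - 1)) := by
  have hgk := hd.pos k
  have hrec : (p k : ℝ) - A (k + 1) * p (k + 1) + p (k + 2) = 0 := by exact_mod_cast hd.rec_eq k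
  have hkR : (1 : ℝ) ≤ z k - A (k + 1) * z (k + 1) + z (k + 2) := by exact_mod_cast hk
  have hA : (A (k + 1) : ℝ) = g (k + 1) + (g k)⁻¹ := by
    rw [hd.coeff, show k + 1 + 1 = k + 2 by ring, hd.periodic]
  have hr := h.right (k + 1)
  have hl := h.left (k + 2)
  rw [show k + 1 + 1 = k + 2 by ring] at hr
  rw [show k + 2 - 1 = k + 1 by ring, hd.periodic] at hl
  have hz1 : (0 : ℝ) ≤ z (k + 1) := by exact_mod_cast h.nonneg _
  have hl' : (g k)⁻¹ * ((p (k + 1) : ℝ) - z (k + 1)) ≤ p (k + 2) - z (k + 2) := by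
    rwa [inv_mul_le_iff₀ hgk]
  have hzk : (g k)⁻¹ * (z (k + 1) : ℝ) ≤ z k - 1 := by
    rw [hA] at hkR; linarith
  have hwk : (p k : ℝ) - (z k - 1) ≤ g (k + 1) * (p (k + 1) - z (k + 1)) := by
    rw [hA] at hkR hrec; linarith
  have hz0 : (0 : ℝ) ≤ z k - 1 := le_trans (by positivity) hzk
  have hz0' : 0 ≤ z k - 1 := by exact_mod_cast hz0
  rw [inv_mul_le_iff₀ hgk] at hzk
  refine ⟨fun j => ?_, fun j => ?_, fun j => ?_, fun j => ?_⟩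
  · rcases eq_or_ne j k with rfl | hj
    · simpa using hz0'
    · simpa [hj] using h.nonneg j
  · rcases eq_or_ne j k with rfl | hj
    · have := h.le j
      simp only [update_self]; omega
    · simpa [hj] using h.le j
  · rcases eq_or_ne j k with rfl | hj
    · simpa using hzk
    · have := h.right j
      rcases eq_or_ne (j + 1) k with rfl | hj'
      · simp only [update_self, update_of_ne hj]; push_cast; linarith
      · simpa [hj, hj'] using this
  · rcases eq_or_ne j k with rfl | hj
    · have := h.left j
      have hj' : j - 1 ≠ j := by omega
      simp only [update_self, update_of_ne hj']; push_cast; linarith [hd.pos j]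
    · rcases eq_or_ne (j - 1) k with rfl | hj'
      · simp only [update_self, update_of_ne hj]
        rw [show j - 1 + 1 = j by ring] at hwk
        push_cast; linarith
      · simpa [hj, hj'] using h.left j

theorem Admissible.update_add_one (hd : RecurrenceData g A p) (h : Admissible g p z)
    (hk : z (k - 2) - A (k - 1) * z (k - 1) + z k < 0) :
    Admissible g p (update z k (z k + 1)) := by
  have hgk := hd.pos k
  have hrec : (p (k - 2) : ℝ) - A (k - 1) * p (k - 1) + p k = 0 := by
    have := hd.rec_eq (k - 2)
    rw [show k - 2 + 1 = k - 1 by ring, show k - 2 + 2 = k by ring] at this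
    exact_mod_cast this
  have hkR : (z (k - 2) : ℝ) - A (k - 1) * z (k - 1) + z k ≤ -1 := by
    have : z (k - 2) - A (k - 1) * z (k - 1) + z k ≤ -1 := by omega
    exact_mod_cast this
  have hper : g (k - 2) = g k := by rw [← hd.periodic, show k - 2 + 2 = k by ring]
  have hA : (A (k - 1) : ℝ) = g (k - 1) + (g k)⁻¹ := by
    rw [hd.coeff, show k - 1 + 1 = k by ring]
  have hr := h.right (k - 2)
  have hl := h.left (k - 1)
  rw [show k - 2 + 1 = k - 1 by ring, hper] at hr
  rw [show k - 1 - 1 = k - 2 by ring] at hl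
  have hw1 : (0 : ℝ) ≤ p (k - 1) - z (k - 1) := sub_nonneg.2 (by exact_mod_cast h.le _)
  have hr' : (g k)⁻¹ * (z (k - 1) : ℝ) ≤ z (k - 2) := by rwa [inv_mul_le_iff₀ hgk]
  have hzk : (z k : ℝ) + 1 ≤ g (k - 1) * z (k - 1) := by
    rw [hA] at hkR; linarith
  have hwk : (g k)⁻¹ * ((p (k - 1) : ℝ) - z (k - 1)) ≤ p k - (z k + 1) := by
    rw [hA] at hkR hrec; linarith
  have hw0 : (0 : ℝ) ≤ p k - (z k + 1) := le_trans (by positivity) hwk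
  have hw0' : z k + 1 ≤ p k := by exact_mod_cast sub_nonneg.1 hw0
  rw [inv_mul_le_iff₀ hgk] at hwk
  refine ⟨fun j => ?_, fun j => ?_, fun j => ?_, fun j => ?_⟩
  · rcases eq_or_ne j k with rfl | hj
    · have := h.nonneg j
      simp only [update_self]; omega
    · simpa [hj] using h.nonneg j
  · rcases eq_or_ne j k with rfl | hj
    · simpa using hw0'
    · simpa [hj] using h.le j
  · rcases eq_or_ne j k with rfl | hj
    · have := h.right j
      have hj' : j + 1 ≠ j := by omega
      simp only [update_self, update_of_ne hj']; push_cast; linarith [hd.pos j]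
    · rcases eq_or_ne (j + 1) k with rfl | hj'
      · simp only [update_self, update_of_ne hj]
        rw [show j + 1 - 1 = j by ring] at hzk
        push_cast; linarith
      · simpa [hj, hj'] using h.right j
  · rcases eq_or_ne j k with rfl | hj
    · have hj' : j - 1 ≠ j := by omega
      simp only [update_self, update_of_ne hj']; push_cast; linarith
    · rcases eq_or_ne (j - 1) k with rfl | hj'
      · have := h.left j
        simp only [update_self, update_of_ne hj]; push_cast; linarith
      · simpa [hj, hj'] using h.left j

theorem alphaR_pos (ha1 : 1 ≤ a1) (ha2 : 1 ≤ a2) : 0 < alphaR a1 a2 := by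
  have h1 : (0 : ℝ) < a1 := by exact_mod_cast ha1
  have h2 : (0 : ℝ) < a2 := by exact_mod_cast ha2
  unfold alphaR; positivity

theorem betaR_pos (ha1 : 1 ≤ a1) (ha2 : 1 ≤ a2) : 0 < betaR a1 a2 := by
  have h1 : (0 : ℝ) < a1 := by exact_mod_cast ha1
  have h2 : (0 : ℝ) < a2 := by exact_mod_cast ha2
  unfold betaR; positivity

theorem gammaR_pos (ha1 : 1 ≤ a1) (ha2 : 1 ≤ a2) (k : ℤ) : 0 < gammaR a1 a2 k := by
  unfold gammaR; split_ifs
  exacts [alphaR_pos ha1 ha2, betaR_pos ha1 ha2]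

theorem alphaR_add_inv_betaR (ha1 : 1 ≤ a1) (ha2 : 1 ≤ a2) (ha : 4 < a1 * a2) :
    alphaR a1 a2 + (betaR a1 a2)⁻¹ = a1 ∧ betaR a1 a2 + (alphaR a1 a2)⁻¹ = a2 := by
  have h1 : (0 : ℝ) < a1 := by exact_mod_cast ha1
  have h2 : (0 : ℝ) < a2 := by exact_mod_cast ha2
  have h4 : (4 : ℝ) < a1 * a2 := by exact_mod_cast ha
  have hs := Real.sq_sqrt (show (0 : ℝ) ≤ (a1 : ℝ) ^ 2 * (a2 : ℝ) ^ 2 - 4 * a1 * a2 by nlinarith)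
  have hs0 := Real.sqrt_nonneg ((a1 : ℝ) ^ 2 * (a2 : ℝ) ^ 2 - 4 * a1 * a2)
  unfold alphaR betaR
  set s := Real.sqrt ((a1 : ℝ) ^ 2 * (a2 : ℝ) ^ 2 - 4 * a1 * a2)
  have hD : (0 : ℝ) < a1 * a2 + s := by linarith
  constructor <;> field_simp <;> nlinarith

theorem gammaR_congr {j k : ℤ} (h : j % 2 = k % 2) : gammaR a1 a2 j = gammaR a1 a2 k := by
  simp [gammaR, h]

theorem recCoeff_eq (ha1 : 1 ≤ a1) (ha2 : 1 ≤ a2) (ha : 4 < a1 * a2) (k : ℤ) :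
    (recCoeff a1 a2 k : ℝ) = gammaR a1 a2 k + (gammaR a1 a2 (k + 1))⁻¹ := by
  obtain ⟨h1, h2⟩ := alphaR_add_inv_betaR ha1 ha2 ha
  rcases Int.emod_two_eq_zero_or_one k with h | h
  · rw [recCoeff, gammaR, gammaR, if_neg (by omega), if_pos h, if_neg (by omega), h1]
  · rw [recCoeff, gammaR, gammaR, if_pos h, if_neg (by omega), if_pos (by omega), h2]

theorem pseq_rec (k : ℤ) :
    pseq a1 a2 k1 k2 k - recCoeff a1 a2 (k + 1) * pseq a1 a2 k1 k2 (k + 1) +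
      pseq a1 a2 k1 k2 (k + 2) = 0 := by
  rcases le_or_gt 0 k with hk | hk
  · lift k to ℕ using hk
    rw [pseq, pseq, pseq, if_pos (by omega), if_pos (by omega), if_pos (by omega),
      show ((k : ℤ) + 1).toNat = k + 1 by omega, show ((k : ℤ) + 2).toNat = k + 2 by omega,
      Int.toNat_natCast, ppos, recCoeff]
    rcases Nat.mod_two_eq_zero_or_one k with h | h
    · rw [if_pos (by omega), if_pos h]; ring
    · rw [if_neg (by omega), if_neg (by omega)]; ring
  · rcases eq_or_ne k (-1) with rfl | hk'
    · simp [pseq, pneg, ppos, recCoeff]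
    · obtain ⟨n, rfl⟩ : ∃ n : ℕ, k = -((n : ℤ) + 2) := ⟨(-k - 2).toNat, by omega⟩
      have hneg : ∀ m : ℕ, pseq a1 a2 k1 k2 (-(m : ℤ)) = pneg a1 a2 k1 k2 m := by
        rintro (_ | m)
        · simp [pseq, ppos, pneg]
        · rw [pseq, if_neg (by omega), neg_neg, Int.toNat_natCast]
      have e0 := hneg (n + 2)
      have e1 := hneg (n + 1)
      push_cast at e0 e1
      rw [show -((n : ℤ) + 2) + 1 = -((n : ℤ) + 1) by ring,
        show -((n : ℤ) + 2) + 2 = -(n : ℤ) by ring, hneg, e0, e1, pneg, recCoeff]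
      rcases Nat.mod_two_eq_zero_or_one n with h | h
      · rw [if_pos (by omega), if_pos (by omega)]; ring
      · rw [if_neg (by omega), if_neg (by omega)]; ring

theorem recurrenceData (ha1 : 1 ≤ a1) (ha2 : 1 ≤ a2) (ha : 4 < a1 * a2) (k1 k2 : ℤ) :
    RecurrenceData (gammaR a1 a2) (recCoeff a1 a2) (pseq a1 a2 k1 k2) where
  pos := gammaR_pos ha1 ha2
  periodic k := gammaR_congr (by omega)
  coeff := recCoeff_eq ha1 ha2 ha
  rec_eq := pseq_rec

/-- Shift the coordinates at nonpositive positions by `p`. -/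
def shift (p x : ℤ → ℤ) (k : ℤ) : ℤ := if 1 ≤ k then x k else p k + x k

theorem shift_of_pos (hk : 1 ≤ k) : shift p x k = x k := if_pos hk

theorem shift_of_nonpos (hk : k ≤ 0) : shift p x k = p k + x k := if_neg (by omega)

theorem shift_update (c : ℤ) :
    shift p (update x k (x k + c)) = update (shift p x) k (shift p x k + c) := by
  ext j
  rcases eq_or_ne j k with rfl | hj
  · simp only [shift, update_self]; split_ifs <;> ring
  · simp [shift, hj]

theorem zmem_iff : ZMem x ↔ (∀ k, 1 ≤ k → 0 ≤ x k) ∧ (∀ k, k ≤ 0 → x k ≤ 0) ∧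
    (support x).Finite := by
  constructor
  · rintro ⟨⟨-, h1, N, hN⟩, -, h2, M, hM⟩
    refine ⟨fun k hk => ?_, fun k hk => ?_, (Set.finite_Icc (-(M : ℤ)) N).subset fun k hk => ?_⟩
    · simpa [posPart, hk] using h1 k
    · simpa [negPart, hk] using h2 k
    · rw [mem_support] at hk
      by_contra hc
      rw [Set.mem_Icc, not_and_or, not_le, not_le] at hc
      rcases hc with hc | hc
      · have := hM k hc
        rw [negPart, if_pos (by omega)] at this
        exact hk this
      · have := hN k hc
        rw [posPart, if_pos (by omega)] at this
        exact hk this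
  · rintro ⟨h1, h2, hf⟩
    obtain ⟨N, hN⟩ := hf.bddAbove
    obtain ⟨M, hM⟩ := hf.bddBelow
    refine ⟨⟨fun k hk => if_neg (by omega), fun k => ?_, N.toNat, fun k hk => ?_⟩,
      fun k hk => if_neg (by omega), fun k => ?_, (-M).toNat, fun k hk => ?_⟩
    · unfold posPart; split_ifs with hk
      exacts [h1 k hk, le_rfl]
    · have : x k = 0 := by
        by_contra hx
        have := hN (mem_support.2 hx)
        omega
      simp [posPart, this]
    · unfold negPart; split_ifs with hk
      exacts [h2 k hk, le_rfl]
    · have : x k = 0 := by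
        by_contra hx
        have := hM (mem_support.2 hx)
        omega
      simp [negPart, this]

theorem sigmaMem_iff : SigmaMem a1 a2 k1 k2 x ↔ (support x).Finite ∧
    Admissible (gammaR a1 a2) (pseq a1 a2 k1 k2) (shift (pseq a1 a2 k1 k2) x) := by
  rw [SigmaMem, zmem_iff, SigmaCond]
  set p := pseq a1 a2 k1 k2
  constructor
  · rintro ⟨⟨hpos, hneg, hf⟩, h0, h1, h2, h3, h4, h5, h6, h7⟩
    refine ⟨hf, fun k => ?_, fun k => ?_, fun k => ?_, fun k => ?_⟩
    · rcases le_or_gt 1 k with hk | hk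
      · rw [shift_of_pos hk]; exact hpos k hk
      · rw [shift_of_nonpos (by omega)]; exact_mod_cast h5 k (by omega)
    · rcases le_or_gt 1 k with hk | hk
      · rw [shift_of_pos hk]; exact_mod_cast sub_nonneg.1 (h2 k hk)
      · rw [shift_of_nonpos (by omega)]; linarith [hneg k (by omega)]
    · rcases lt_trichotomy k 0 with hk | rfl | hk
      · have := h7 (k + 1) (by omega)
        rw [show k + 1 - 1 = k by ring] at this
        rw [shift_of_nonpos (by omega), shift_of_nonpos (by omega)]
        push_cast; linarith
      · rw [shift_of_pos (by omega), shift_of_nonpos le_rfl]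
        push_cast; linarith
      · have := h3 k (by omega)
        rw [shift_of_pos (by omega), shift_of_pos (by omega)]
        linarith
    · rcases lt_trichotomy k 1 with hk | rfl | hk
      · have := h6 k (by omega)
        rw [shift_of_nonpos (by omega), shift_of_nonpos (by omega)]
        push_cast; linarith
      · rw [shift_of_pos le_rfl, shift_of_nonpos (by omega)]
        push_cast; linarith
      · have := h4 (k - 1) (by omega)
        rw [show k - 1 + 1 = k by ring] at this
        rw [shift_of_pos (by omega), shift_of_pos (by omega)]
        linarith
  · rintro ⟨hf, h⟩
    refine ⟨⟨fun k hk => ?_, fun k hk => ?_, hf⟩, ?_, ?_, fun k hk => ?_, fun k hk => ?_,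
      fun k hk => ?_, fun k hk => ?_, fun k hk => ?_, fun k hk => ?_⟩
    · simpa [shift_of_pos hk] using h.nonneg k
    · simpa [shift_of_nonpos hk] using h.le k
    · have := h.right 0
      rw [shift_of_pos (by omega), shift_of_nonpos le_rfl] at this
      push_cast at this; linarith
    · have := h.left 1
      rw [shift_of_pos le_rfl, shift_of_nonpos (by omega)] at this
      push_cast at this; linarith
    · have := h.le k
      rw [shift_of_pos hk] at this
      exact sub_nonneg.2 (by exact_mod_cast this)
    · have := h.right k
      rw [shift_of_pos (by omega), shift_of_pos hk] at this
      linarith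
    · have := h.left (k + 1)
      rw [show k + 1 - 1 = k by ring, shift_of_pos hk, shift_of_pos (by omega)] at this
      linarith
    · have := h.nonneg k
      rw [shift_of_nonpos hk] at this
      exact_mod_cast this
    · have := h.left k
      rw [shift_of_nonpos hk, shift_of_nonpos (by omega)] at this
      push_cast at this; linarith
    · have := h.right (k - 1)
      rw [show k - 1 + 1 = k by ring, shift_of_nonpos hk, shift_of_nonpos (by omega)] at this
      push_cast at this; linarith

theorem gammaR_mul_cseq_le (ha1 : 1 ≤ a1) (ha2 : 1 ≤ a2) (ha : 4 < a1 * a2) (n : ℕ) :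
    0 ≤ cseq a1 a2 n ∧ gammaR a1 a2 (n + 1) * cseq a1 a2 n ≤ cseq a1 a2 (n + 1) := by
  induction n with
  | zero => simp [cseq]
  | succ n ih =>
    obtain ⟨h0, h1⟩ := ih
    have h0' : (0 : ℝ) ≤ cseq a1 a2 n := by exact_mod_cast h0
    have hg := gammaR_pos ha1 ha2 ((n : ℤ) + 1)
    have hA : ((if n % 2 = 0 then a1 else a2 : ℤ) : ℝ) =
        gammaR a1 a2 (n + 2) + (gammaR a1 a2 (n + 1))⁻¹ := by
      rw [← gammaR_congr (j := (n : ℤ) + 2 + 1) (k := (n : ℤ) + 1) (by omega),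
        ← recCoeff_eq ha1 ha2 ha, recCoeff]
      rcases Nat.mod_two_eq_zero_or_one n with h | h
      · rw [if_pos h, if_neg (by omega)]
      · rw [if_neg (by omega), if_pos (by omega)]
    refine ⟨by exact_mod_cast (mul_nonneg hg.le h0').trans h1, ?_⟩
    rw [← le_inv_mul_iff₀ hg] at h1
    rw [cseq, Nat.cast_succ, add_assoc, one_add_one_eq_two, Int.cast_sub, Int.cast_mul, hA]
    linarith

theorem gammaR_mul_cseq'_le (ha1 : 1 ≤ a1) (ha2 : 1 ≤ a2) (ha : 4 < a1 * a2) (n : ℕ) :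
    0 ≤ cseq' a1 a2 n ∧ gammaR a1 a2 n * cseq' a1 a2 n ≤ cseq' a1 a2 (n + 1) := by
  induction n with
  | zero => simp [cseq']
  | succ n ih =>
    obtain ⟨h0, h1⟩ := ih
    have h0' : (0 : ℝ) ≤ cseq' a1 a2 n := by exact_mod_cast h0
    have hg := gammaR_pos ha1 ha2 (n : ℤ)
    have hA : ((if n % 2 = 0 then a2 else a1 : ℤ) : ℝ) =
        gammaR a1 a2 (n + 1) + (gammaR a1 a2 n)⁻¹ := by
      rw [← gammaR_congr (j := (n : ℤ) + 1 + 1) (k := (n : ℤ)) (by omega),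
        ← recCoeff_eq ha1 ha2 ha, recCoeff]
      rcases Nat.mod_two_eq_zero_or_one n with h | h
      · rw [if_pos h, if_pos (by omega)]
      · rw [if_neg (by omega), if_neg (by omega)]
    refine ⟨by exact_mod_cast (mul_nonneg hg.le h0').trans h1, ?_⟩
    rw [← le_inv_mul_iff₀ hg] at h1
    rw [cseq', Nat.cast_succ, Int.cast_sub, Int.cast_mul, hA]
    linarith

theorem SigmaMem.xxMem (ha1 : 1 ≤ a1) (ha2 : 1 ≤ a2) (ha : 4 < a1 * a2)
    (h : SigmaMem a1 a2 k1 k2 x) : XXMem a1 a2 x := by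
  obtain ⟨hz, -, -, -, h3, -, -, h6, -⟩ := h
  obtain ⟨hpos, hneg, -⟩ := zmem_iff.1 hz
  refine ⟨⟨hz.1, fun j hj => ?_⟩, hz.2, fun j hj => ?_⟩
  · rw [posPart, posPart, if_pos hj, if_pos (by omega)]
    obtain ⟨n, rfl⟩ : ∃ n : ℕ, j = n + 1 := ⟨(j - 1).toNat, by omega⟩
    rw [show ((n : ℤ) + 1).toNat = n + 1 by omega, show ((n : ℤ) + 1 - 1).toNat = n by omega]
    obtain ⟨hc0, hc⟩ := gammaR_mul_cseq_le ha1 ha2 ha n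
    have hc0' : (0 : ℝ) ≤ cseq a1 a2 n := by exact_mod_cast hc0
    have hx : (0 : ℝ) ≤ x (n + 1) := by exact_mod_cast hpos _ hj
    have key : (0 : ℝ) ≤ cseq a1 a2 (n + 1) * x (n + 1) - cseq a1 a2 n * x (n + 1 + 1) := by
      nlinarith [mul_le_mul_of_nonneg_right hc hx, mul_nonneg hc0' (h3 _ hj)]
    exact_mod_cast key
  · rw [negPart, negPart, if_pos hj, if_pos (by omega)]
    obtain ⟨n, rfl⟩ : ∃ n : ℕ, j = -(n : ℤ) := ⟨(-j).toNat, by omega⟩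
    rw [show (1 - -(n : ℤ)).toNat = n + 1 by omega, show (- -(n : ℤ)).toNat = n by omega]
    obtain ⟨hc0, hc⟩ := gammaR_mul_cseq'_le ha1 ha2 ha n
    have hc0' : (0 : ℝ) ≤ cseq' a1 a2 n := by exact_mod_cast hc0
    have hx : (0 : ℝ) ≤ -x (-(n : ℤ)) := by exact_mod_cast neg_nonneg.2 (hneg _ hj)
    have h6' := h6 _ hj
    rw [gammaR_congr (k := (n : ℤ)) (by omega)] at h6'
    have key : (cseq' a1 a2 (n + 1) : ℝ) * x (-(n : ℤ)) - cseq' a1 a2 n * x (-(n : ℤ) - 1) ≤ 0 := by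
      nlinarith [mul_le_mul_of_nonneg_right hc hx, mul_nonneg hc0' h6']
    exact_mod_cast key

theorem idx_congr {j k : ℤ} (h : j % 2 = k % 2) : idx j = idx k := by simp [idx, h]

theorem finite_support_of_eq_zero {f : ℤ → ℤ} (hf : (support x).Finite)
    (h : ∀ j, x j = 0 → f j = 0) : (support f).Finite :=
  hf.subset fun j hj hx => hj (h j hx)

theorem pairW_wtZ (μ : ℤ × ℤ) (k : ℤ) :
    pairW (wtZ a1 a2 μ x) (idx k) = pairW μ (idx k) - ∑ᶠ j : ℤ, pairJK a1 a2 j k * x j := by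
  rcases Int.emod_two_eq_zero_or_one k with h | h
  · have e : ∀ j, x j * (alphaOf a1 a2 j).2 = pairJK a1 a2 j k * x j := by
      intro j
      rcases Int.emod_two_eq_zero_or_one j with h' | h' <;> simp [alphaOf, pairJK, h, h', mul_comm]
    simp [pairW, idx, h, wtZ, wtOf, e, sub_eq_add_neg]
  · have e : ∀ j, x j * (alphaOf a1 a2 j).1 = pairJK a1 a2 j k * x j := by
      intro j
      rcases Int.emod_two_eq_zero_or_one j with h' | h' <;> simp [alphaOf, pairJK, h, h', mul_comm]
    simp [pairW, idx, h, wtZ, wtOf, e, sub_eq_add_neg]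

theorem sigmaZ_eq (hf : (support x).Finite) (μ : ℤ × ℤ) (k : ℤ) :
    sigmaZ a1 a2 μ x k = sigmaP a1 a2 x k - if 1 ≤ k then 0 else pairW μ (idx k) := by
  unfold sigmaZ
  split_ifs with hk
  · ring
  · have e : ∀ j, pairJK a1 a2 j k * x j =
        ((if j < k then pairJK a1 a2 j k * x j else 0) +
          (if k < j then pairJK a1 a2 j k * x j else 0)) + (if j = k then 2 * x j else 0) := by
      intro j
      rcases lt_trichotomy j k with h | rfl | h
      · simp [h, h.ne, h.not_gt]
      · simp [pairJK]
      · simp [h, h.ne', h.not_gt]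
    have f1 := finite_support_of_eq_zero (f := fun j => if j < k then pairJK a1 a2 j k * x j else 0)
      hf (by intro j hj; simp [hj])
    have f2 := finite_support_of_eq_zero (f := fun j => if k < j then pairJK a1 a2 j k * x j else 0)
      hf (by intro j hj; simp [hj])
    have f3 := finite_support_of_eq_zero (f := fun j => if j = k then 2 * x j else 0)
      hf (by intro j hj; simp [hj])
    have f12 := finite_support_of_eq_zero
      (f := fun j => (if j < k then pairJK a1 a2 j k * x j else 0) +
        if k < j then pairJK a1 a2 j k * x j else 0) hf (by intro j hj; simp [hj])
    rw [pairW_wtZ, finsum_congr e, finsum_add_distrib f12 f3, finsum_add_distrib f1 f2,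
      finsum_eq_single (fun j => if j = k then 2 * x j else 0) k (fun j hj => if_neg hj),
      sigmaM, sigmaP, if_pos rfl]
    ring

theorem sigmaP_sub (hf : (support x).Finite) (k : ℤ) :
    sigmaP a1 a2 x k - sigmaP a1 a2 x (k + 2) =
      x k - recCoeff a1 a2 (k + 1) * x (k + 1) + x (k + 2) := by
  have e : ∀ j, (if k < j then pairJK a1 a2 j k * x j else 0) =
      ((if k + 2 < j then pairJK a1 a2 j (k + 2) * x j else 0) +
        (if j = k + 1 then -recCoeff a1 a2 (k + 1) * x j else 0)) +
        (if j = k + 2 then 2 * x j else 0) := by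
    intro j
    have hp : pairJK a1 a2 j (k + 2) = pairJK a1 a2 j k := by simp [pairJK]
    rw [hp]
    rcases lt_or_ge (k + 2) j with h | h
    · rw [if_pos (by omega), if_pos h, if_neg (by omega), if_neg (by omega)]; ring
    rw [if_neg (by omega : ¬ k + 2 < j)]
    rcases eq_or_ne j (k + 2) with rfl | h2
    · simp [pairJK]
    rcases eq_or_ne j (k + 1) with rfl | h1
    · rcases Int.emod_two_eq_zero_or_one k with h' | h'
      · have : (k + 1) % 2 = 1 := by omega
        simp [pairJK, recCoeff, h', this]
      · have : (k + 1) % 2 = 0 := by omega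
        simp [pairJK, recCoeff, h', this]
    · rw [if_neg (by omega), if_neg h1, if_neg h2]; ring
  have f1 := finite_support_of_eq_zero
    (f := fun j => if k + 2 < j then pairJK a1 a2 j (k + 2) * x j else 0)
    hf (by intro j hj; simp [hj])
  have f2 := finite_support_of_eq_zero
    (f := fun j => if j = k + 1 then -recCoeff a1 a2 (k + 1) * x j else 0)
    hf (by intro j hj; simp [hj])
  have f3 := finite_support_of_eq_zero (f := fun j => if j = k + 2 then 2 * x j else 0)
    hf (by intro j hj; simp [hj])
  have f12 := finite_support_of_eq_zero
    (f := fun j => (if k + 2 < j then pairJK a1 a2 j (k + 2) * x j else 0) +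
      if j = k + 1 then -recCoeff a1 a2 (k + 1) * x j else 0) hf (by intro j hj; simp [hj])
  rw [sigmaP, sigmaP, finsum_congr e, finsum_add_distrib f12 f3, finsum_add_distrib f1 f2,
    finsum_eq_single (fun j => if j = k + 2 then 2 * x j else 0) (k + 2) (fun j hj => if_neg hj),
    finsum_eq_single (fun j => if j = k + 1 then -recCoeff a1 a2 (k + 1) * x j else 0) (k + 1)
      (fun j hj => if_neg hj), if_pos rfl, if_pos rfl]
  ring

/-- In shifted coordinates the differences of `σ` obey a single formula at all positions. -/
theorem sigmaZ_sub (hf : (support x).Finite) (k : ℤ) :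
    sigmaZ a1 a2 (lamW k1 k2) x k - sigmaZ a1 a2 (lamW k1 k2) x (k + 2) =
      shift (pseq a1 a2 k1 k2) x k -
        recCoeff a1 a2 (k + 1) * shift (pseq a1 a2 k1 k2) x (k + 1) +
        shift (pseq a1 a2 k1 k2) x (k + 2) := by
  have hs := sigmaP_sub (a1 := a1) (a2 := a2) hf k
  have hp := pseq_rec (a1 := a1) (a2 := a2) (k1 := k1) (k2 := k2) k
  rw [sigmaZ_eq hf, sigmaZ_eq hf, idx_congr (show (k + 2) % 2 = k % 2 by omega)]
  rcases le_or_gt 1 k with hk | hk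
  · rw [shift_of_pos hk, shift_of_pos (by omega), shift_of_pos (by omega), if_pos hk,
      if_pos (by omega)]
    linarith
  rcases eq_or_ne k 0 with rfl | h0
  · have e : pseq a1 a2 k1 k2 0 = k2 := by simp [pseq, ppos]
    rw [shift_of_nonpos le_rfl, shift_of_pos (by omega), shift_of_pos (by omega), e]
    simp [pairW, idx, lamW] at hs ⊢
    linarith
  rcases eq_or_ne k (-1) with rfl | h1
  · have e : pseq a1 a2 k1 k2 1 = k1 := by simp [pseq, ppos]
    rw [shift_of_nonpos (by omega), shift_of_nonpos (by omega), shift_of_pos (by omega)]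
    simp [pairW, idx, lamW, e] at hs hp ⊢
    linarith
  · rw [shift_of_nonpos (by omega), shift_of_nonpos (by omega), shift_of_nonpos (by omega),
      if_neg (by omega), if_neg (by omega)]
    linarith

theorem exists_sigmaZ_eq_zero (hf : (support x).Finite) (μ : ℤ × ℤ) :
    ∃ N : ℤ, ∀ k, N < k → sigmaZ a1 a2 μ x k = 0 := by
  obtain ⟨N, hN⟩ := hf.bddAbove
  have hx : ∀ j, N < j → x j = 0 := fun j hj => by
    by_contra hc
    exact absurd (hN (mem_support.2 hc)) (by omega)
  refine ⟨max N 0, fun k hk => ?_⟩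
  have e : ∀ j, (if k < j then pairJK a1 a2 j k * x j else 0) = 0 := fun j => by
    split_ifs with h
    · rw [hx j (by omega), mul_zero]
    · rfl
  rw [sigmaZ, if_pos (by omega), sigmaP, finsum_congr e, finsum_zero, hx k (by omega), add_zero]

theorem exists_sigmaZ_eq_neg_pairW (hf : (support x).Finite) (μ : ℤ × ℤ) :
    ∃ N : ℤ, ∀ k, k < N → sigmaZ a1 a2 μ x k = -pairW (wtZ a1 a2 μ x) (idx k) := by
  obtain ⟨N, hN⟩ := hf.bddBelow
  have hx : ∀ j, j < N → x j = 0 := fun j hj => by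
    by_contra hc
    exact absurd (hN (mem_support.2 hc)) (by omega)
  refine ⟨min N 0, fun k hk => ?_⟩
  have e : ∀ j, (if j < k then pairJK a1 a2 j k * x j else 0) = 0 := fun j => by
    split_ifs with h
    · rw [hx j (by omega), mul_zero]
    · rfl
  rw [sigmaZ, if_neg (by omega), sigmaM, finsum_congr e, finsum_zero, hx k (by omega)]
  ring

theorem epsZ_isGreatest (hf : (support x).Finite) (μ : ℤ × ℤ) {i : ℤ} (hi : IsI i) :
    IsGreatest {s : ℤ | ∃ k : ℤ, idx k = i ∧ sigmaZ a1 a2 μ x k = s} (epsZ a1 a2 μ x i) := by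
  obtain ⟨N, hN⟩ := exists_sigmaZ_eq_zero (a1 := a1) (a2 := a2) hf μ
  obtain ⟨M, hM⟩ := exists_sigmaZ_eq_neg_pairW (a1 := a1) (a2 := a2) hf μ
  have hne : {s : ℤ | ∃ k : ℤ, idx k = i ∧ sigmaZ a1 a2 μ x k = s}.Nonempty := by
    rcases hi with rfl | rfl
    exacts [⟨_, 1, rfl, rfl⟩, ⟨_, 0, rfl, rfl⟩]
  have hbdd : BddAbove {s : ℤ | ∃ k : ℤ, idx k = i ∧ sigmaZ a1 a2 μ x k = s} := by
    have hfin : (insert 0 (insert (-pairW (wtZ a1 a2 μ x) i)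
        ((sigmaZ a1 a2 μ x) '' Set.Icc M N))).Finite :=
      (((Set.finite_Icc M N).image _).insert _).insert _
    refine hfin.bddAbove.mono ?_
    rintro s ⟨k, rfl, rfl⟩
    rcases lt_or_ge N k with h | h
    · exact Or.inl (hN k h)
    rcases lt_or_ge k M with h' | h'
    · exact Or.inr (Or.inl (hM k h'))
    · exact Or.inr (Or.inr ⟨k, ⟨h', h⟩, rfl⟩)
  exact ⟨Int.csSup_mem hne hbdd, fun s hs => le_csSup hbdd hs⟩

theorem sigmaZ_kmaxZ_add_two_lt (hf : (support x).Finite) (μ : ℤ × ℤ) {i : ℤ} (hi : IsI i)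
    (h : 0 < epsZ a1 a2 μ x i) :
    sigmaZ a1 a2 μ x (kmaxZ a1 a2 μ x i + 2) < sigmaZ a1 a2 μ x (kmaxZ a1 a2 μ x i) := by
  have hg := epsZ_isGreatest (a1 := a1) (a2 := a2) hf μ hi
  obtain ⟨N, hN⟩ := exists_sigmaZ_eq_zero (a1 := a1) (a2 := a2) hf μ
  have hbdd : BddAbove {k : ℤ | idx k = i ∧ sigmaZ a1 a2 μ x k = epsZ a1 a2 μ x i} := by
    refine ⟨N, fun k hk => ?_⟩
    by_contra hc
    have := hN k (not_le.1 hc)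
    linarith [hk.2]
  obtain ⟨hk1, hk2⟩ : kmaxZ a1 a2 μ x i ∈ _ := Int.csSup_mem hg.1 hbdd
  have hidx : idx (kmaxZ a1 a2 μ x i + 2) = i := (idx_congr (by omega)).trans hk1
  rw [hk2]
  refine lt_of_le_of_ne (hg.2 ⟨_, hidx, rfl⟩) fun he => ?_
  have : kmaxZ a1 a2 μ x i + 2 ≤ kmaxZ a1 a2 μ x i := le_csSup hbdd ⟨hidx, he⟩
  omega

theorem sigmaZ_kminZ_sub_two_lt (hf : (support x).Finite) (μ : ℤ × ℤ) {i : ℤ} (hi : IsI i)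
    (h : 0 < phiZ a1 a2 μ x i) :
    sigmaZ a1 a2 μ x (kminZ a1 a2 μ x i - 2) < sigmaZ a1 a2 μ x (kminZ a1 a2 μ x i) := by
  have hg := epsZ_isGreatest (a1 := a1) (a2 := a2) hf μ hi
  obtain ⟨N, hN⟩ := exists_sigmaZ_eq_neg_pairW (a1 := a1) (a2 := a2) hf μ
  have hbdd : BddBelow {k : ℤ | idx k = i ∧ sigmaZ a1 a2 μ x k = epsZ a1 a2 μ x i} := by
    refine ⟨N, fun k hk => ?_⟩
    by_contra hc
    have := hN k (not_le.1 hc)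
    rw [hk.1, hk.2] at this
    rw [phiZ] at h
    linarith
  obtain ⟨hk1, hk2⟩ : kminZ a1 a2 μ x i ∈ _ := Int.csInf_mem hg.1 hbdd
  have hidx : idx (kminZ a1 a2 μ x i - 2) = i := (idx_congr (by omega)).trans hk1
  rw [hk2]
  refine lt_of_le_of_ne (hg.2 ⟨_, hidx, rfl⟩) fun he => ?_
  have : kminZ a1 a2 μ x i ≤ kminZ a1 a2 μ x i - 2 := csInf_le hbdd ⟨hidx, he⟩
  omega

theorem finite_support_update (hf : (support x).Finite) (k c : ℤ) :
    (support (update x k c)).Finite := by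
  refine (hf.insert k).subset fun j hj => ?_
  rcases eq_or_ne j k with rfl | h
  · exact Or.inl rfl
  · exact Or.inr (by simpa [h] using hj)

theorem SigmaMem.eZ (ha1 : 1 ≤ a1) (ha2 : 1 ≤ a2) (ha : 4 < a1 * a2)
    (h : SigmaMem a1 a2 k1 k2 x) {i : ℤ} (hi : IsI i) {y : ℤ → ℤ}
    (hy : eZ a1 a2 (lamW k1 k2) i x = some y) : SigmaMem a1 a2 k1 k2 y := by
  rw [HypCrystal.eZ] at hy
  split_ifs at hy with hpos
  obtain rfl := Option.some.inj hy
  obtain ⟨hf, hadm⟩ := sigmaMem_iff.1 h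
  refine sigmaMem_iff.2 ⟨finite_support_update hf _ _, ?_⟩
  rw [sub_eq_add_neg, shift_update, ← sub_eq_add_neg]
  refine hadm.update_sub_one (recurrenceData ha1 ha2 ha k1 k2) ?_
  rw [← sigmaZ_sub hf, sub_pos]
  exact sigmaZ_kmaxZ_add_two_lt hf _ hi hpos

theorem SigmaMem.fZ (ha1 : 1 ≤ a1) (ha2 : 1 ≤ a2) (ha : 4 < a1 * a2)
    (h : SigmaMem a1 a2 k1 k2 x) {i : ℤ} (hi : IsI i) {y : ℤ → ℤ}
    (hy : fZ a1 a2 (lamW k1 k2) i x = some y) : SigmaMem a1 a2 k1 k2 y := by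
  rw [HypCrystal.fZ] at hy
  split_ifs at hy with hpos
  obtain rfl := Option.some.inj hy
  obtain ⟨hf, hadm⟩ := sigmaMem_iff.1 h
  refine sigmaMem_iff.2 ⟨finite_support_update hf _ _, ?_⟩
  rw [shift_update]
  refine hadm.update_add_one (recurrenceData ha1 ha2 ha k1 k2) ?_
  have hlt := sigmaZ_kminZ_sub_two_lt hf _ hi hpos
  have hs := sigmaZ_sub (a1 := a1) (a2 := a2) (k1 := k1) (k2 := k2) hf
    (kminZ a1 a2 (lamW k1 k2) x i - 2)
  rw [show kminZ a1 a2 (lamW k1 k2) x i - 2 + 2 = kminZ a1 a2 (lamW k1 k2) x i by ring,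
    show kminZ a1 a2 (lamW k1 k2) x i - 2 + 1 = kminZ a1 a2 (lamW k1 k2) x i - 1 by ring] at hs
  linarith

end HypCrystal

open HypCrystal in
theorem sigmaMem_is_subcrystal
    (a1 a2 : ℤ) (ha1 : 1 ≤ a1) (ha2 : 1 ≤ a2) (ha : 4 < a1 * a2)
    (k1 k2 : ℤ) (hk1 : 0 < k1) (hk2 : 0 < k2)
    (hreg : 2 ≤ a1 → 2 ≤ a2 →
      (k2 ≤ k1 ∧ k1 < (a1 - 1) * k2) ∨ (k1 < k2 ∧ k2 ≤ (a2 - 1) * k1))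
    (hdeg1 : a1 = 1 → 2 * k1 ≤ k2 ∧ k2 ≤ (a2 - 2) * k1)
    (hdeg2 : a2 = 1 → 2 * k2 ≤ k1 ∧ k1 ≤ (a1 - 2) * k2) :
    ∀ x : ℤ → ℤ, SigmaMem a1 a2 k1 k2 x →
      XXMem a1 a2 x ∧
      ∀ i : ℤ, IsI i →
        (∀ y : ℤ → ℤ, eZ a1 a2 (lamW k1 k2) i x = some y → SigmaMem a1 a2 k1 k2 y) ∧
        (∀ y : ℤ → ℤ, fZ a1 a2 (lamW k1 k2) i x = some y → SigmaMem a1 a2 k1 k2 y) := by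
  exact fun x hx => ⟨hx.xxMem ha1 ha2 ha, fun i hi =>
    ⟨fun y hy => hx.eZ ha1 ha2 ha hi hy, fun y hy => hx.fZ ha1 ha2 ha hi hy⟩⟩
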